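/- arXiv:1401.5411 — 4 statements merged into one kernel-verified Lean document; each statement's English description precedes it below -/
import Mathlib

section
/- For every integer m ≥ 3, one has I_m^{m/2} = 2 K_m^{−m} / (α_m² (m−2)² ω_{m−1}), where I_m^{m/2} = ∫₀^∞ r^{m/2} (1 + r)^{−m} dr, α_m = (m(m−2))^{(m−2)/4}, ω_{m−1} is the (m−1)-dimensional surface measure of the unit sphere S^{m−1} ⊂ ℝ^m, and K_m = sqrt(4 / (m(m−2) ω_m^{2/m})) with ω_m the m-dimensional surface measure of the unit sphere S^m ⊂ ℝ^{m+1}. -/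
open MeasureTheory Metric

/-- `I^q_p = ∫₀^∞ r^q (1+r)^{-p} dr`. -/
noncomputable def Iint (q p : ℝ) : ℝ :=
  ∫ r in Set.Ioi (0 : ℝ), r ^ q * (1 + r) ^ (-p)

/-- `α_m = (m(m-2))^{(m-2)/4}`. -/
noncomputable def alphaConst (m : ℕ) : ℝ :=
  ((m : ℝ) * ((m : ℝ) - 2)) ^ (((m : ℝ) - 2) / 4)

/-- `ω_k`: the `k`-dimensional surface measure of the unit sphere `S^k ⊂ ℝ^{k+1}`,
which equals `(k+1)` times the volume of the unit ball of `ℝ^{k+1}`. -/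
noncomputable def omegaSphere (k : ℕ) : ℝ :=
  ((k : ℝ) + 1) * (volume (ball (0 : EuclideanSpace ℝ (Fin (k + 1))) 1)).toReal

/-- `K_m = sqrt(4 / (m(m-2) ω_m^{2/m}))`. -/
noncomputable def Kconst (m : ℕ) : ℝ :=
  Real.sqrt (4 / ((m : ℝ) * ((m : ℝ) - 2) * omegaSphere m ^ ((2 : ℝ) / (m : ℝ))))

/-- The Beta integral on `(0, ∞)`, in terms of the Gamma function. -/
theorem Iint_eq_Gamma {q p : ℝ} (hq : -1 < q) (hpq : 1 < p - q) :
    Iint q p = Real.Gamma (q + 1) * Real.Gamma (p - q - 1) / Real.Gamma p := by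
  have himage : (fun x : ℝ => x / (1 - x)) '' Set.Ioo 0 1 = Set.Ioi 0 := by
    ext y
    simp only [Set.mem_image, Set.mem_Ioo, Set.mem_Ioi]
    constructor
    · rintro ⟨x, ⟨h0, h1⟩, rfl⟩
      exact div_pos h0 (by linarith)
    · intro hy
      refine ⟨y / (1 + y), ⟨by positivity, ?_⟩, ?_⟩
      · rw [div_lt_one (by positivity)]
        linarith
      · have : 1 - y / (1 + y) = 1 / (1 + y) := by
          field_simp
          ring
        rw [this]
        field_simp
  have hderiv : ∀ x ∈ Set.Ioo (0 : ℝ) 1,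
      HasDerivWithinAt (fun x : ℝ => x / (1 - x)) (1 / (1 - x) ^ 2) (Set.Ioo 0 1) x := by
    intro x hx
    have hne : 1 - x ≠ 0 := by linarith [hx.2]
    convert! ((hasDerivAt_id x).div ((hasDerivAt_id x).const_sub 1) hne).hasDerivWithinAt using 1
    simp
  have hinj : Set.InjOn (fun x : ℝ => x / (1 - x)) (Set.Ioo 0 1) := by
    intro x hx y hy hxy
    have hx' : 1 - x ≠ 0 := by linarith [hx.2]
    have hy' : 1 - y ≠ 0 := by linarith [hy.2]
    simp only at hxy
    rw [div_eq_div_iff hx' hy'] at hxy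
    linarith
  have hbeta : ∫ x in Set.Ioo (0 : ℝ) 1, x ^ q * (1 - x) ^ (p - q - 2) =
      ProbabilityTheory.beta (q + 1) (p - q - 1) := by
    rw [ProbabilityTheory.beta_eq_betaIntegralReal _ _ (by linarith) (by linarith),
      Complex.betaIntegral, intervalIntegral.integral_of_le zero_le_one,
      integral_Ioc_eq_integral_Ioo, ← Complex.ofReal_re (∫ x in Set.Ioo (0 : ℝ) 1, _),
      ← integral_complex_ofReal]
    congr 1
    refine setIntegral_congr_fun measurableSet_Ioo fun x hx => ?_
    have h1 : 0 ≤ 1 - x := by linarith [hx.2]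
    rw [Complex.ofReal_mul, Complex.ofReal_cpow hx.1.le, Complex.ofReal_cpow h1]
    push_cast
    ring_nf
  rw [Iint, ← himage, integral_image_eq_integral_abs_deriv_smul measurableSet_Ioo hderiv hinj]
  trans ProbabilityTheory.beta (q + 1) (p - q - 1)
  · rw [← hbeta]
    refine setIntegral_congr_fun measurableSet_Ioo fun x hx => ?_
    have h1 : 0 < 1 - x := by linarith [hx.2]
    have hsum : 1 + x / (1 - x) = (1 - x)⁻¹ := by
      field_simp
      ring
    simp only [smul_eq_mul]
    rw [hsum, abs_of_pos (by positivity), Real.div_rpow hx.1.le h1.le, Real.inv_rpow h1.le,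
      Real.rpow_neg h1.le, inv_inv, Real.rpow_sub h1, Real.rpow_sub h1, Real.rpow_two]
    field_simp
  · rw [ProbabilityTheory.beta]
    congr 2
    ring

theorem omegaSphere_eq (k : ℕ) :
    omegaSphere k = 2 * √Real.pi ^ (k + 1) / Real.Gamma (((k : ℝ) + 1) / 2) := by
  have hk : (0 : ℝ) < ((k : ℝ) + 1) / 2 := by positivity
  have hG := Real.Gamma_pos_of_pos hk
  rw [omegaSphere, EuclideanSpace.volume_ball, Fintype.card_fin]
  push_cast
  rw [Real.Gamma_add_one hk.ne', ENNReal.ofReal_one, one_pow, one_mul,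
    ENNReal.toReal_ofReal (by positivity)]
  field_simp

theorem omegaSphere_pos (k : ℕ) : 0 < omegaSphere k := by
  have hG := Real.Gamma_pos_of_pos (show (0 : ℝ) < ((k : ℝ) + 1) / 2 by positivity)
  rw [omegaSphere_eq]
  positivity

theorem Kconst_rpow_neg {m : ℕ} (hm : 3 ≤ m) :
    Kconst m ^ (-(m : ℝ)) =
      ((m : ℝ) * ((m : ℝ) - 2)) ^ ((m : ℝ) / 2) * omegaSphere m * (2 : ℝ) ^ (-(m : ℝ)) := by
  have hm' : (3 : ℝ) ≤ m := by exact_mod_cast hm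
  have hA : 0 < (m : ℝ) * ((m : ℝ) - 2) := mul_pos (by linarith) (by linarith)
  have hω := omegaSphere_pos m
  have hω' : 0 < omegaSphere m ^ ((2 : ℝ) / (m : ℝ)) := Real.rpow_pos_of_pos hω _
  rw [Kconst, Real.sqrt_eq_rpow, ← Real.rpow_mul (by positivity),
    show (1 / 2 : ℝ) * -(m : ℝ) = -((m : ℝ) / 2) by ring, Real.rpow_neg (by positivity),
    Real.div_rpow (by norm_num) (by positivity), Real.mul_rpow hA.le hω'.le,
    ← Real.rpow_mul hω.le, show (2 : ℝ) / m * (m / 2) = 1 by field_simp, Real.rpow_one, inv_div,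
    show (4 : ℝ) = 2 ^ (2 : ℝ) by norm_num, ← Real.rpow_mul (by norm_num),
    show (2 : ℝ) * (m / 2) = m by ring, Real.rpow_neg (by norm_num), div_eq_mul_inv]

theorem alphaConst_sq {m : ℕ} (hm : 3 ≤ m) :
    alphaConst m ^ 2 =
      ((m : ℝ) * ((m : ℝ) - 2)) ^ ((m : ℝ) / 2) / ((m : ℝ) * ((m : ℝ) - 2)) := by
  have hm' : (3 : ℝ) ≤ m := by exact_mod_cast hm
  have hA : 0 < (m : ℝ) * ((m : ℝ) - 2) := mul_pos (by linarith) (by linarith)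
  rw [alphaConst, ← Real.rpow_mul_natCast hA.le, ← Real.rpow_sub_one hA.ne']
  congr 1
  push_cast
  ring

/-- For every `m ≥ 3`, `I_m^{m/2} = 2 K_m^{-m} / (α_m² (m-2)² ω_{m-1})`. -/
theorem Iint_halfm (m : ℕ) (hm : 3 ≤ m) :
    Iint ((m : ℝ) / 2) (m : ℝ) =
      2 * Kconst m ^ (-(m : ℝ)) /
        (alphaConst m ^ 2 * ((m : ℝ) - 2) ^ 2 * omegaSphere (m - 1)) := by
  have hm' : (3 : ℝ) ≤ m := by exact_mod_cast hm
  have hm2 : 0 < (m : ℝ) - 2 := by linarith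
  have hA : 0 < (m : ℝ) * ((m : ℝ) - 2) := mul_pos (by linarith) hm2
  have hP := Real.rpow_pos_of_pos hA ((m : ℝ) / 2)
  have hs : 0 < (m : ℝ) / 2 - 1 := by linarith
  have hG2 := Real.Gamma_pos_of_pos (show 0 < (m : ℝ) / 2 by linarith)
  have hG3 := Real.Gamma_pos_of_pos (show 0 < ((m : ℝ) + 1) / 2 by linarith)
  have hG4 := Real.Gamma_pos_of_pos (show 0 < (m : ℝ) by linarith)
  have hrec : Real.Gamma ((m : ℝ) / 2) = ((m : ℝ) / 2 - 1) * Real.Gamma ((m : ℝ) / 2 - 1) := by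
    rw [← Real.Gamma_add_one hs.ne', sub_add_cancel]
  have hdup := Real.Gamma_mul_Gamma_add_half ((m : ℝ) / 2)
  rw [show (m : ℝ) / 2 + 1 / 2 = ((m : ℝ) + 1) / 2 by ring, mul_div_cancel₀ _ two_ne_zero,
    sub_eq_add_neg, Real.rpow_add two_pos, Real.rpow_one] at hdup
  have hcast : ((m - 1 : ℕ) : ℝ) + 1 = m := by
    rw [Nat.cast_sub (by omega), Nat.cast_one, sub_add_cancel]
  rw [Iint_eq_Gamma (by linarith) (by linarith), Kconst_rpow_neg hm, alphaConst_sq hm,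
    omegaSphere_eq, omegaSphere_eq, hcast, Nat.sub_add_cancel (by omega),
    Real.Gamma_add_one (by linarith), show (m : ℝ) - m / 2 - 1 = m / 2 - 1 by ring, pow_succ]
  have hπ : 0 < √Real.pi := Real.sqrt_pos.mpr Real.pi_pos
  have hGm : Real.Gamma ((m : ℝ) / 2 - 1) = 2 * Real.Gamma ((m : ℝ) / 2) / (m - 2) := by
    rw [hrec]
    field_simp
  rw [hGm]
  field_simp
  linear_combination hdup
end

section
/- For every integer m ≥ 5 and every index i ∈ {1, …, m}, the standard bubble satisfies the weighted Pohozaev-type identity (1/2) ∫_{ℝ^m} |∇U(z)|² z_i² dz − (1/2*_m) ∫_{ℝ^m} U(z)^{2*_m} z_i² dz = ∫_{ℝ^m} (∂U/∂z_i(z))² z_i² dz, all three integrals being finite. -/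
open MeasureTheory

/-- The standard bubble `U(z) = α_m (1 + |z|²)^{-(m-2)/2}` on `ℝ^m`. -/
noncomputable def bubble (m : ℕ) (z : EuclideanSpace ℝ (Fin m)) : ℝ :=
  ((m : ℝ) * ((m : ℝ) - 2)) ^ (((m : ℝ) - 2) / 4) * (1 + ‖z‖ ^ 2) ^ (-(((m : ℝ) - 2) / 2))

open Filter Topology

section BracketWeights

variable {m : ℕ}

lemma abs_coord_le_bracket (z : EuclideanSpace ℝ (Fin m)) (i : Fin m) :
    |z i| ≤ (1 + ‖z‖ ^ 2) ^ (1 / 2 : ℝ) := by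
  rw [← Real.sqrt_eq_rpow]
  refine Real.le_sqrt_of_sq_le ?_
  have h := PiLp.norm_apply_le z i
  rw [Real.norm_eq_abs] at h
  have := pow_le_pow_left₀ (abs_nonneg (z i)) h 2
  linarith

/-- A continuous function of growth `(1 + |z|²)^a` times `(1 + |z|²)^{-p}` is integrable as soon
as `2 (p - a)` exceeds the dimension. -/
lemma integrable_mul_bracket_rpow {h : EuclideanSpace ℝ (Fin m) → ℝ} (hc : Continuous h)
    {a p : ℝ} (hb : ∀ z, |h z| ≤ (1 + ‖z‖ ^ 2) ^ a) (hp : (m : ℝ) < 2 * (p - a)) :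
    Integrable (fun z => h z * (1 + ‖z‖ ^ 2) ^ (-p)) := by
  have hint : Integrable (fun z : EuclideanSpace ℝ (Fin m) =>
      ((1 : ℝ) + ‖z‖ ^ 2) ^ (-(2 * (p - a)) / 2)) :=
    integrable_rpow_neg_one_add_norm_sq (by simpa using hp)
  refine hint.mono' ?_ (Eventually.of_forall fun z => ?_)
  · refine (hc.mul (Continuous.rpow_const (by fun_prop) fun z => Or.inl ?_)).aestronglyMeasurable
    positivity
  · have hs : (0 : ℝ) < 1 + ‖z‖ ^ 2 := by positivity
    rw [Real.norm_eq_abs, abs_mul, abs_of_pos (Real.rpow_pos_of_pos hs (-p))]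
    refine (mul_le_mul_of_nonneg_right (hb z) (Real.rpow_pos_of_pos hs _).le).trans_eq ?_
    rw [← Real.rpow_add hs]
    congr 1
    ring

lemma integrable_sq_coord_mul_bracket_rpow (i : Fin m) {p : ℝ} (hp : (m : ℝ) < 2 * (p - 1)) :
    Integrable (fun z : EuclideanSpace ℝ (Fin m) => z i ^ 2 * (1 + ‖z‖ ^ 2) ^ (-p)) := by
  refine integrable_mul_bracket_rpow (a := 1) (by fun_prop) (fun z => ?_) hp
  have hs : (0 : ℝ) < 1 + ‖z‖ ^ 2 := by positivity
  calc |z i ^ 2| = |z i| ^ 2 := abs_pow _ _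
    _ ≤ ((1 + ‖z‖ ^ 2) ^ (1 / 2 : ℝ)) ^ 2 := by gcongr; exact abs_coord_le_bracket z i
    _ = _ := by rw [← Real.rpow_natCast, ← Real.rpow_mul hs.le]; norm_num

lemma integrable_sq_coord_mul_sq_coord_mul_bracket_rpow (i j : Fin m) {p : ℝ}
    (hp : (m : ℝ) < 2 * (p - 2)) :
    Integrable (fun z : EuclideanSpace ℝ (Fin m) =>
      (z j ^ 2 * z i ^ 2) * (1 + ‖z‖ ^ 2) ^ (-p)) := by
  refine integrable_mul_bracket_rpow (a := 2) (by fun_prop) (fun z => ?_) hp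
  have hs : (0 : ℝ) < 1 + ‖z‖ ^ 2 := by positivity
  calc |z j ^ 2 * z i ^ 2| = |z j| ^ 2 * |z i| ^ 2 := by rw [abs_mul, abs_pow, abs_pow]
    _ ≤ ((1 + ‖z‖ ^ 2) ^ (1 / 2 : ℝ)) ^ 2 * ((1 + ‖z‖ ^ 2) ^ (1 / 2 : ℝ)) ^ 2 := by
        gcongr <;> exact abs_coord_le_bracket z _
    _ = _ := by
        rw [← Real.rpow_natCast, ← Real.rpow_mul hs.le, ← Real.rpow_add hs]; norm_num

lemma integrable_coord_mul_sq_coord_mul_bracket_rpow (i j : Fin m) {p : ℝ}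
    (hp : (m : ℝ) < 2 * (p - 3 / 2)) :
    Integrable (fun z : EuclideanSpace ℝ (Fin m) =>
      (z j * z i ^ 2) * (1 + ‖z‖ ^ 2) ^ (-p)) := by
  refine integrable_mul_bracket_rpow (a := 3 / 2) (by fun_prop) (fun z => ?_) hp
  have hs : (0 : ℝ) < 1 + ‖z‖ ^ 2 := by positivity
  calc |z j * z i ^ 2| = |z j| * |z i| ^ 2 := by rw [abs_mul, abs_pow]
    _ ≤ (1 + ‖z‖ ^ 2) ^ (1 / 2 : ℝ) * ((1 + ‖z‖ ^ 2) ^ (1 / 2 : ℝ)) ^ 2 := by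
        gcongr <;> exact abs_coord_le_bracket z _
    _ = _ := by
        generalize 1 + ‖z‖ ^ 2 = s at hs ⊢
        rw [← Real.rpow_natCast, ← Real.rpow_mul hs.le, ← Real.rpow_add hs]; norm_num

lemma hasGradientAt_bracket_rpow (q : ℝ) (z : EuclideanSpace ℝ (Fin m)) :
    HasGradientAt (fun z : EuclideanSpace ℝ (Fin m) => ((1 : ℝ) + ‖z‖ ^ 2) ^ q)
      ((2 * q * (1 + ‖z‖ ^ 2) ^ (q - 1)) • z) z := by
  have hs : (0 : ℝ) < 1 + ‖z‖ ^ 2 := by positivity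
  have h := (((hasStrictFDerivAt_norm_sq z).hasFDerivAt.const_add 1).rpow_const (p := q)
    (Or.inl hs.ne'))
  rw [hasGradientAt_iff_hasFDerivAt]
  refine h.congr_fderiv ?_
  ext y
  simp
  ring

lemma hasLineDerivAt_coord_mul_sq_coord (i j : Fin m) (z : EuclideanSpace ℝ (Fin m)) :
    HasLineDerivAt ℝ (fun z : EuclideanSpace ℝ (Fin m) => z j * z i ^ 2)
      ((if j = i then 3 else 1) * z i ^ 2) z (EuclideanSpace.single j 1) := by
  have hcoord (k : Fin m) : HasDerivAt
      (fun t : ℝ => (z + t • EuclideanSpace.single j (1 : ℝ)) k) (if k = j then 1 else 0) 0 := by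
    by_cases h : k = j
    · subst h
      simpa using (hasDerivAt_id (0 : ℝ)).const_add (z k)
    · simpa [h] using hasDerivAt_const (0 : ℝ) (z k)
  have h := (hcoord j).mul ((hcoord i).pow 2)
  refine HasDerivAt.congr_deriv (f := fun t : ℝ => _) h ?_
  by_cases hij : j = i
  · subst hij
    simp
    ring
  · simp [hij, Ne.symm hij]

/-- Integration by parts of `z_j z_i² (1 + |z|²)^{1-p}` in the direction `j`, in the range of
exponents where this function is itself integrable. -/
lemma integral_sq_coord_mul_bracket_rpow_of_lt (i j : Fin m) {p : ℝ} (hp : (m : ℝ) + 5 < 2 * p) :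
    2 * (p - 1) * ∫ z : EuclideanSpace ℝ (Fin m), (z j ^ 2 * z i ^ 2) * (1 + ‖z‖ ^ 2) ^ (-p) =
      (if j = i then 3 else 1) *
        ∫ z : EuclideanSpace ℝ (Fin m), z i ^ 2 * (1 + ‖z‖ ^ 2) ^ (-(p - 1)) := by
  have key := integral_bilinear_hasLineDerivAt_right_eq_neg_left_of_integrable
    (μ := (volume : Measure (EuclideanSpace ℝ (Fin m))))
    (B := ContinuousLinearMap.mul ℝ ℝ)
    (f := fun z : EuclideanSpace ℝ (Fin m) => z j * z i ^ 2)
    (f' := fun z : EuclideanSpace ℝ (Fin m) => (if j = i then 3 else 1) * z i ^ 2)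
    (g := fun z : EuclideanSpace ℝ (Fin m) => ((1 : ℝ) + ‖z‖ ^ 2) ^ (-(p - 1)))
    (g' := fun z : EuclideanSpace ℝ (Fin m) =>
      -(2 * (p - 1)) * (1 + ‖z‖ ^ 2) ^ (-p) * z j)
    (v := EuclideanSpace.single j 1) ?_ ?_ ?_
    (fun z _ => hasLineDerivAt_coord_mul_sq_coord i j z) (fun z _ => ?_)
  · simp only [ContinuousLinearMap.mul_apply'] at key
    have h1 : ∀ z : EuclideanSpace ℝ (Fin m),
        z j * z i ^ 2 * (-(2 * (p - 1)) * (1 + ‖z‖ ^ 2) ^ (-p) * z j) =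
        -(2 * (p - 1)) * ((z j ^ 2 * z i ^ 2) * (1 + ‖z‖ ^ 2) ^ (-p)) := fun z => by ring
    simp only [h1, mul_assoc (if j = i then (3 : ℝ) else 1), integral_const_mul] at key
    linarith
  · simp only [ContinuousLinearMap.mul_apply', mul_assoc (if j = i then (3 : ℝ) else 1)]
    exact (integrable_sq_coord_mul_bracket_rpow i (by linarith)).const_mul _
  · refine ((integrable_sq_coord_mul_sq_coord_mul_bracket_rpow i j (p := p)
      (by linarith)).const_mul (-(2 * (p - 1)))).congr (Eventually.of_forall fun z => ?_)
    simp only [ContinuousLinearMap.mul_apply']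
    ring
  · exact integrable_coord_mul_sq_coord_mul_bracket_rpow i j (by linarith)
  · have h := (hasGradientAt_bracket_rpow (-(p - 1)) z).hasFDerivAt.hasLineDerivAt
      (EuclideanSpace.single j 1)
    convert h using 1
    rw [InnerProductSpace.toDual_apply_apply, inner_smul_left, EuclideanSpace.inner_single_right]
    simp only [conj_trivial, one_mul, show -(p - 1) - 1 = -p by ring]
    ring

lemma tendsto_integral_mul_bracket_rpow {h : EuclideanSpace ℝ (Fin m) → ℝ} (hc : Continuous h)
    {p : ℝ} (hint : Integrable (fun z => h z * (1 + ‖z‖ ^ 2) ^ (-p))) :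
    Tendsto (fun q : ℝ => ∫ z, h z * (1 + ‖z‖ ^ 2) ^ (-q)) (𝓝[>] p)
      (𝓝 (∫ z, h z * (1 + ‖z‖ ^ 2) ^ (-p))) := by
  refine tendsto_integral_filter_of_dominated_convergence
    (fun z => ‖h z * (1 + ‖z‖ ^ 2) ^ (-p)‖) (Eventually.of_forall fun q => ?_) ?_ hint.norm
    (Eventually.of_forall fun z => ?_)
  · refine (hc.mul (Continuous.rpow_const (by fun_prop) fun z => Or.inl ?_)).aestronglyMeasurable
    positivity
  · filter_upwards [self_mem_nhdsWithin] with q hq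
    refine Eventually.of_forall fun z => ?_
    have hs : (0 : ℝ) < 1 + ‖z‖ ^ 2 := by positivity
    rw [norm_mul, norm_mul, Real.norm_of_nonneg (Real.rpow_pos_of_pos hs _).le,
      Real.norm_of_nonneg (Real.rpow_pos_of_pos hs _).le]
    refine mul_le_mul_of_nonneg_left (Real.rpow_le_rpow_of_exponent_le ?_ ?_) (norm_nonneg _)
    · nlinarith [sq_nonneg ‖z‖]
    · exact neg_le_neg (Set.mem_Ioi.mp hq).le
  · have hs : (0 : ℝ) < 1 + ‖z‖ ^ 2 := by positivity
    refine (tendsto_const_nhds.mul ?_).mono_left nhdsWithin_le_nhds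
    exact ((Real.continuousAt_const_rpow hs.ne').comp continuousAt_neg).tendsto

lemma integral_sq_coord_mul_bracket_rpow (i j : Fin m) {p : ℝ} (hp : (m : ℝ) + 5 ≤ 2 * p) :
    2 * (p - 1) * ∫ z : EuclideanSpace ℝ (Fin m), (z j ^ 2 * z i ^ 2) * (1 + ‖z‖ ^ 2) ^ (-p) =
      (if j = i then 3 else 1) *
        ∫ z : EuclideanSpace ℝ (Fin m), z i ^ 2 * (1 + ‖z‖ ^ 2) ^ (-(p - 1)) := by
  have hL := tendsto_integral_mul_bracket_rpow
    (h := fun z : EuclideanSpace ℝ (Fin m) => z j ^ 2 * z i ^ 2) (by fun_prop)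
    (integrable_sq_coord_mul_sq_coord_mul_bracket_rpow i j (p := p) (by linarith))
  have hR := tendsto_integral_mul_bracket_rpow
    (h := fun z : EuclideanSpace ℝ (Fin m) => z i ^ 2) (by fun_prop)
    (integrable_sq_coord_mul_bracket_rpow i (p := p - 1) (by linarith))
  have hsub : Tendsto (fun q : ℝ => q - 1) (𝓝[>] p) (𝓝[>] (p - 1)) := by
    refine tendsto_nhdsWithin_iff.mpr
      ⟨((continuous_sub_right (1 : ℝ)).tendsto p).mono_left nhdsWithin_le_nhds, ?_⟩
    filter_upwards [self_mem_nhdsWithin] with q hq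
    exact sub_lt_sub_right (Set.mem_Ioi.mp hq) 1
  have hcoef : Tendsto (fun q : ℝ => 2 * (q - 1)) (𝓝[>] p) (𝓝 (2 * (p - 1))) :=
    (Continuous.tendsto (by fun_prop) p).mono_left nhdsWithin_le_nhds
  refine tendsto_nhds_unique (hcoef.mul hL)
    (((hR.comp hsub).const_mul (if j = i then (3 : ℝ) else 1)).congr' ?_)
  filter_upwards [self_mem_nhdsWithin] with q hq
  have hq : p < q := hq
  exact (integral_sq_coord_mul_bracket_rpow_of_lt i j (by linarith)).symm

end BracketWeights

lemma hasGradientAt_bubble (m : ℕ) (z : EuclideanSpace ℝ (Fin m)) :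
    HasGradientAt (bubble m)
      ((-((m : ℝ) * ((m : ℝ) - 2)) ^ (((m : ℝ) - 2) / 4) * ((m : ℝ) - 2) *
        (1 + ‖z‖ ^ 2) ^ (-((m : ℝ) / 2))) • z) z := by
  have h := (hasGradientAt_bracket_rpow (-(((m : ℝ) - 2) / 2)) z).hasFDerivAt.const_mul
    (((m : ℝ) * ((m : ℝ) - 2)) ^ (((m : ℝ) - 2) / 4))
  rw [hasGradientAt_iff_hasFDerivAt]
  refine HasFDerivAt.congr_fderiv (f := bubble m) h ?_
  ext y
  simp only [show -(((m : ℝ) - 2) / 2) - 1 = -((m : ℝ) / 2) by ring,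
    smul_apply, InnerProductSpace.toDual_apply_apply, inner_smul_left,
    conj_trivial, smul_eq_mul]
  ring

lemma bubble_rpow_critical {m : ℕ} (hm : 3 ≤ m) (z : EuclideanSpace ℝ (Fin m)) :
    bubble m z ^ (2 * (m : ℝ) / ((m : ℝ) - 2)) =
      (((m : ℝ) * ((m : ℝ) - 2)) ^ (((m : ℝ) - 2) / 4)) ^ 2 * ((m : ℝ) * ((m : ℝ) - 2)) *
        (1 + ‖z‖ ^ 2) ^ (-(m : ℝ)) := by
  have hm' : (3 : ℝ) ≤ m := by exact_mod_cast hm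
  have hs : (0 : ℝ) < 1 + ‖z‖ ^ 2 := by positivity
  have hM : (0 : ℝ) < (m : ℝ) * ((m : ℝ) - 2) := by nlinarith
  have h2 : (m : ℝ) - 2 ≠ 0 := by linarith
  rw [bubble, Real.mul_rpow (Real.rpow_pos_of_pos hM _).le (Real.rpow_pos_of_pos hs _).le,
    ← Real.rpow_mul hM.le, ← Real.rpow_mul hs.le, ← Real.rpow_mul_natCast hM.le]
  congr 1
  · rw [← Real.rpow_add_one hM.ne']
    congr 1
    field_simp
    push_cast
    ring
  · congr 1
    field_simp

/-- For every `m ≥ 5` and every `i ∈ {1, …, m}`, the weighted Pohozaev-type identity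
`(1/2) ∫ |∇U|² zᵢ² - (1/2*_m) ∫ U^{2*_m} zᵢ² = ∫ (∂U/∂zᵢ)² zᵢ²` holds,
all three integrals being finite. -/
theorem bubble_weighted_pohozaev (m : ℕ) (hm : 5 ≤ m) (i : Fin m) :
    Integrable (fun z : EuclideanSpace ℝ (Fin m) => ‖gradient (bubble m) z‖ ^ 2 * z i ^ 2) ∧
    Integrable (fun z : EuclideanSpace ℝ (Fin m) =>
      bubble m z ^ (2 * (m : ℝ) / ((m : ℝ) - 2)) * z i ^ 2) ∧
    Integrable (fun z : EuclideanSpace ℝ (Fin m) =>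
      (fderiv ℝ (bubble m) z (EuclideanSpace.single i 1)) ^ 2 * z i ^ 2) ∧
    (1 / 2) * (∫ z : EuclideanSpace ℝ (Fin m), ‖gradient (bubble m) z‖ ^ 2 * z i ^ 2) -
      (1 / (2 * (m : ℝ) / ((m : ℝ) - 2))) *
        (∫ z : EuclideanSpace ℝ (Fin m),
          bubble m z ^ (2 * (m : ℝ) / ((m : ℝ) - 2)) * z i ^ 2) =
      ∫ z : EuclideanSpace ℝ (Fin m),
        (fderiv ℝ (bubble m) z (EuclideanSpace.single i 1)) ^ 2 * z i ^ 2 := by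
  have hm' : (5 : ℝ) ≤ m := by exact_mod_cast hm
  set α : ℝ := ((m : ℝ) * ((m : ℝ) - 2)) ^ (((m : ℝ) - 2) / 4)
  have hpow (z : EuclideanSpace ℝ (Fin m)) :
      (((1 : ℝ) + ‖z‖ ^ 2) ^ (-((m : ℝ) / 2))) ^ 2 = (1 + ‖z‖ ^ 2) ^ (-(m : ℝ)) := by
    rw [← Real.rpow_natCast, ← Real.rpow_mul (by positivity)]
    congr 1
    push_cast
    ring
  have hgrad (z : EuclideanSpace ℝ (Fin m)) : ‖gradient (bubble m) z‖ ^ 2 * z i ^ 2 =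
      α ^ 2 * ((m : ℝ) - 2) ^ 2 *
        ∑ j, (z j ^ 2 * z i ^ 2) * (1 + ‖z‖ ^ 2) ^ (-(m : ℝ)) := by
    rw [(hasGradientAt_bubble m z).gradient, norm_smul, mul_pow, Real.norm_eq_abs, sq_abs,
      mul_pow, hpow, ← Finset.sum_mul, ← Finset.sum_mul, ← EuclideanSpace.real_norm_sq_eq]
    ring
  have hcrit (z : EuclideanSpace ℝ (Fin m)) :
      bubble m z ^ (2 * (m : ℝ) / ((m : ℝ) - 2)) * z i ^ 2 =
      α ^ 2 * ((m : ℝ) * ((m : ℝ) - 2)) * (z i ^ 2 * (1 + ‖z‖ ^ 2) ^ (-(m : ℝ))) := by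
    rw [bubble_rpow_critical (by omega)]
    ring
  have hpart (z : EuclideanSpace ℝ (Fin m)) :
      (fderiv ℝ (bubble m) z (EuclideanSpace.single i 1)) ^ 2 * z i ^ 2 =
      α ^ 2 * ((m : ℝ) - 2) ^ 2 * ((z i ^ 2 * z i ^ 2) * (1 + ‖z‖ ^ 2) ^ (-(m : ℝ))) := by
    rw [(hasGradientAt_bubble m z).fderiv_apply, inner_smul_left,
      EuclideanSpace.inner_single_right, mul_pow, ← hpow]
    simp only [conj_trivial, one_mul]
    ring
  have hquart (j : Fin m) := integrable_sq_coord_mul_sq_coord_mul_bracket_rpow i j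
    (p := m) (by linarith)
  have hsq := integrable_sq_coord_mul_bracket_rpow i (p := m) (by linarith)
  simp only [hgrad, hcrit, hpart]
  refine ⟨(integrable_finsetSum _ fun j _ => hquart j).const_mul _, hsq.const_mul _,
    (hquart i).const_mul _, ?_⟩
  simp only [integral_const_mul]
  rw [integral_finsetSum _ fun j _ => hquart j]
  have hparts (j : Fin m) := integral_sq_coord_mul_bracket_rpow i j (p := m) (by linarith)
  have hsplit : ∫ z : EuclideanSpace ℝ (Fin m), z i ^ 2 * (1 + ‖z‖ ^ 2) ^ (-((m : ℝ) - 1)) =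
      (∫ z : EuclideanSpace ℝ (Fin m), z i ^ 2 * (1 + ‖z‖ ^ 2) ^ (-(m : ℝ))) +
      ∑ j, ∫ z : EuclideanSpace ℝ (Fin m),
        (z j ^ 2 * z i ^ 2) * (1 + ‖z‖ ^ 2) ^ (-(m : ℝ)) := by
    rw [← integral_finsetSum _ fun j _ => hquart j,
      ← integral_add hsq (integrable_finsetSum _ fun j _ => hquart j)]
    refine integral_congr_ae (Eventually.of_forall fun z => ?_)
    have hs : (0 : ℝ) < 1 + ‖z‖ ^ 2 := by positivity
    simp only
    rw [← Finset.sum_mul, ← Finset.sum_mul, ← EuclideanSpace.real_norm_sq_eq,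
      show -((m : ℝ) - 1) = -(m : ℝ) + 1 by ring, Real.rpow_add_one hs.ne']
    ring
  have htotal : 2 * ((m : ℝ) - 1) * ∑ j, ∫ z : EuclideanSpace ℝ (Fin m),
        (z j ^ 2 * z i ^ 2) * (1 + ‖z‖ ^ 2) ^ (-(m : ℝ)) =
      ((m : ℝ) + 2) * ∫ z : EuclideanSpace ℝ (Fin m),
        z i ^ 2 * (1 + ‖z‖ ^ 2) ^ (-((m : ℝ) - 1)) := by
    have hcount : ∑ j : Fin m, (if j = i then (3 : ℝ) else 1) = (m : ℝ) + 2 := by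
      have h (j : Fin m) : (if j = i then (3 : ℝ) else 1) = 1 + if j = i then 2 else 0 := by
        split_ifs <;> norm_num
      simp [h, Finset.sum_add_distrib]
    rw [Finset.mul_sum, Finset.sum_congr rfl fun j _ => hparts j, ← Finset.sum_mul, hcount]
  have hdiag := hparts i
  rw [if_pos rfl] at hdiag
  set A := ∑ j, ∫ z : EuclideanSpace ℝ (Fin m),
    (z j ^ 2 * z i ^ 2) * (1 + ‖z‖ ^ 2) ^ (-(m : ℝ))
  set B := ∫ z : EuclideanSpace ℝ (Fin m), z i ^ 2 * (1 + ‖z‖ ^ 2) ^ (-(m : ℝ))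
  set C := ∫ z : EuclideanSpace ℝ (Fin m), z i ^ 2 * (1 + ‖z‖ ^ 2) ^ (-((m : ℝ) - 1))
  set D := ∫ z : EuclideanSpace ℝ (Fin m), (z i ^ 2 * z i ^ 2) * (1 + ‖z‖ ^ 2) ^ (-(m : ℝ))
  have hscaled : (A - B) / 2 = D := by
    have h1 : (2 * ((m : ℝ) - 1)) ≠ 0 := by linarith
    refine mul_left_cancel₀ h1 ?_
    rw [hdiag, show B = C - A by linarith]
    linear_combination htotal
  rw [← hscaled]
  have h2 : (m : ℝ) - 2 ≠ 0 := by linarith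
  have h0 : (m : ℝ) ≠ 0 := by linarith
  field_simp
end

section
/- Let m ≥ 9 be an integer and 2*_m = 2m/(m−2). There exist ε₀ > 0 and a constant C > 0, depending only on m, such that for every real ε with |ε| ≤ ε₀ and every x > 0 and all y, z ∈ ℝ one has |f_ε(x+y) − f_ε(x+z) − f_ε'(x)(y−z)| ≤ C |y−z| (|y| + |z|) (x + |y| + |z|)^{2*_m − 3 − ε}, where f_ε(s) = (max(s,0))^{2*_m − 1 − ε} and f_ε'(x) = (2*_m − 1 − ε) x^{2*_m − 2 − ε}. -/
/-- The tangent line inequality for the convex function `s ↦ (max s 0) ^ (1 + a)`. -/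
theorem tangent_le_max_rpow {a : ℝ} (ha : 0 < a) (s t : ℝ) :
    (1 + a) * max t 0 ^ a * (s - t) ≤ max s 0 ^ (1 + a) - max t 0 ^ (1 + a) := by
  rcases le_or_gt t 0 with ht | ht
  · rw [max_eq_right ht, Real.zero_rpow ha.ne', Real.zero_rpow (by linarith)]
    have := Real.rpow_nonneg (le_max_right s 0) (1 + a)
    linarith
  · rw [max_eq_left ht.le]
    set u := max s 0
    have hu : 0 ≤ u := le_max_right s 0
    have hsu : s ≤ u := le_max_left s 0
    have hta : 0 < t ^ a := Real.rpow_pos_of_pos ht a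
    have bernoulli : 1 + (1 + a) * (u / t - 1) ≤ (1 + (u / t - 1)) ^ (1 + a) :=
      one_add_mul_self_le_rpow_one_add (by linarith [div_nonneg hu ht.le]) (by linarith)
    rw [add_sub_cancel, Real.div_rpow hu ht.le, le_div_iff₀ (by positivity),
      Real.rpow_add ht, Real.rpow_one] at bernoulli
    rw [Real.rpow_add ht, Real.rpow_one]
    have expand : (1 + (1 + a) * (u / t - 1)) * (t * t ^ a)
        = t * t ^ a + (1 + a) * t ^ a * (u - t) := by
      field_simp
    have : (1 + a) * t ^ a * (s - t) ≤ (1 + a) * t ^ a * (u - t) := by gcongr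
    linarith

theorem rpow_sub_rpow_le {a A B : ℝ} (ha : 0 < a) (ha1 : a ≤ 1) (hA : 0 < A) (hB : 0 ≤ B)
    (hBA : B ≤ A) : A ^ a - B ^ a ≤ A ^ (a - 1) * (A - B) := by
  have hAA : A ^ (a - 1) * A = A ^ a := by
    rw [← Real.rpow_add_one hA.ne', sub_add_cancel]
  have hAB : A ^ (a - 1) * B ≤ B ^ a := by
    rcases hB.eq_or_lt with rfl | hB
    · simp [Real.zero_rpow ha.ne']
    · calc A ^ (a - 1) * B ≤ B ^ (a - 1) * B :=
            mul_le_mul_of_nonneg_right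
              (Real.rpow_le_rpow_of_nonpos hB hBA (by linarith)) hB.le
        _ = B ^ a := by rw [← Real.rpow_add_one hB.ne', sub_add_cancel]
  linarith

theorem abs_max_rpow_sub_rpow_le {a x t S : ℝ} (ha : 0 < a) (ha1 : a ≤ 1) (hx : 0 < x)
    (ht : |t| ≤ S) : |max (x + t) 0 ^ a - x ^ a| ≤ 2 * S * (x + S) ^ (a - 1) := by
  have hS : 0 ≤ S := (abs_nonneg t).trans ht
  have hxS : 0 < x + S := by linarith
  obtain ⟨ht₁, ht₂⟩ := abs_le.mp ht
  set u := max (x + t) 0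
  have hu : 0 ≤ u := le_max_right _ _
  have hux : x + t ≤ u := le_max_left _ _
  have huS : u ≤ x + S := max_le (by linarith) hxS.le
  have hpow : 0 < (x + S) ^ (a - 1) := Real.rpow_pos_of_pos hxS _
  refine abs_le.mpr ⟨?_, ?_⟩
  · rcases le_total x u with h | h
    · have := Real.rpow_le_rpow hx.le h ha.le
      have : 0 ≤ 2 * S * (x + S) ^ (a - 1) := by positivity
      linarith
    · have hmin : x - u ≤ x * (2 * S / (x + S)) := by
        rw [← mul_div_assoc, le_div_iff₀ hxS]
        nlinarith [mul_nonneg hx.le (by linarith : 0 ≤ S - (x - u)), mul_nonneg hS hu]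
      have key : x ^ a - u ^ a ≤ 2 * S * (x + S) ^ (a - 1) :=
        calc x ^ a - u ^ a ≤ x ^ (a - 1) * (x - u) := rpow_sub_rpow_le ha ha1 hx hu h
          _ ≤ x ^ (a - 1) * (x * (2 * S / (x + S))) := by gcongr
          _ = x ^ a * (2 * S / (x + S)) := by
            rw [← mul_assoc, ← Real.rpow_add_one hx.ne', sub_add_cancel]
          _ ≤ (x + S) ^ a * (2 * S / (x + S)) := by
            gcongr
            linarith
          _ = 2 * S * (x + S) ^ (a - 1) := by
            rw [Real.rpow_sub_one hxS.ne']
            ring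
      linarith
  · calc u ^ a - x ^ a ≤ (x + S) ^ a - x ^ a := by gcongr
      _ ≤ (x + S) ^ (a - 1) * (x + S - x) :=
        rpow_sub_rpow_le ha ha1 hxS hx.le (by linarith)
      _ ≤ 2 * S * (x + S) ^ (a - 1) := by nlinarith [mul_nonneg hS hpow.le]

theorem abs_max_rpow_sub_sub_le {a x : ℝ} (ha : 0 < a) (ha1 : a ≤ 1) (hx : 0 < x) (y z : ℝ) :
    |max (x + y) 0 ^ (1 + a) - max (x + z) 0 ^ (1 + a) - (1 + a) * x ^ a * (y - z)| ≤
      4 * |y - z| * (|y| + |z|) * (x + |y| + |z|) ^ (a - 1) := by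
  set M := 2 * (|y| + |z|) * (x + (|y| + |z|)) ^ (a - 1) with hM
  have hM0 : 0 ≤ M := by positivity
  have slope : ∀ t, |t| ≤ |y| + |z| →
      |(1 + a) * (max (x + t) 0 ^ a - x ^ a) * (y - z)| ≤ 2 * M * |y - z| := by
    intro t ht
    rw [abs_mul, abs_mul, abs_of_pos (by linarith : 0 < 1 + a)]
    gcongr
    · linarith
    · exact abs_max_rpow_sub_rpow_le ha ha1 hx ht
  have hy := (abs_le.mp (slope y (by linarith [abs_nonneg z]))).2
  have hz := (abs_le.mp (slope z (by linarith [abs_nonneg y]))).1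
  have hyz := tangent_le_max_rpow ha (x + y) (x + z)
  have hzy := tangent_le_max_rpow ha (x + z) (x + y)
  have hrhs : 4 * |y - z| * (|y| + |z|) * (x + |y| + |z|) ^ (a - 1) = 2 * M * |y - z| := by
    rw [hM, ← add_assoc]
    ring
  rw [hrhs]
  refine abs_le.mpr ⟨?_, ?_⟩ <;> linarith

/-- For `m ≥ 9` there exist `ε₀ > 0` and `C > 0`, depending only on `m`, such that for
every `ε` with `|ε| ≤ ε₀`, every `x > 0` and all `y, z ∈ ℝ`,
`|f_ε(x+y) - f_ε(x+z) - f_ε'(x)(y-z)| ≤ C |y-z| (|y|+|z|) (x+|y|+|z|)^{2*_m - 3 - ε}`,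
where `f_ε(s) = (max(s,0))^{2*_m - 1 - ε}` and `f_ε'(x) = (2*_m - 1 - ε) x^{2*_m - 2 - ε}`. -/
theorem f_eps_second_order_bound (m : ℕ) (hm : 9 ≤ m) :
    ∃ ε₀ > (0 : ℝ), ∃ C > (0 : ℝ), ∀ ε : ℝ, |ε| ≤ ε₀ → ∀ x : ℝ, 0 < x → ∀ y z : ℝ,
      |max (x + y) 0 ^ (2 * (m : ℝ) / ((m : ℝ) - 2) - 1 - ε)
          - max (x + z) 0 ^ (2 * (m : ℝ) / ((m : ℝ) - 2) - 1 - ε)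
          - (2 * (m : ℝ) / ((m : ℝ) - 2) - 1 - ε) *
              x ^ (2 * (m : ℝ) / ((m : ℝ) - 2) - 2 - ε) * (y - z)| ≤
        C * |y - z| * (|y| + |z|) *
          (x + |y| + |z|) ^ (2 * (m : ℝ) / ((m : ℝ) - 2) - 3 - ε) := by
  have hm' : (9 : ℝ) ≤ m := by exact_mod_cast hm
  have hm2 : (0 : ℝ) < (m : ℝ) - 2 := by linarith
  refine ⟨2 / ((m : ℝ) - 2), by positivity, 4, by norm_num, fun ε hε x hx y z => ?_⟩
  have hcrit : 2 * (m : ℝ) / ((m : ℝ) - 2) = 2 + 2 * (2 / ((m : ℝ) - 2)) := by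
    field_simp
    ring
  have hsmall : 2 / ((m : ℝ) - 2) ≤ 1 / 3 := by
    rw [div_le_div_iff₀ hm2 (by norm_num)]
    linarith
  have hpos : 0 < 2 / ((m : ℝ) - 2) := by positivity
  obtain ⟨hε₁, hε₂⟩ := abs_le.mp hε
  have main := abs_max_rpow_sub_sub_le (a := 2 * (m : ℝ) / ((m : ℝ) - 2) - 2 - ε)
    (by linarith) (by linarith) hx y z
  convert main using 3 <;> ring_nf
end

section
/- Let m ≥ 9 be an integer and set q = 2m/(m+2). For every η ∈ ℝ^m and every r > 0 there exists a constant C > 0 such that for every δ ∈ (0, 1) one has ∫_{|y| < r} |y|^q |∇_y W_δ(y)|^q dy ≤ C δ^{2q}, where W_δ(y) = δ^{−(m−2)/2} U(y/δ − η), so that |∇_y W_δ(y)| = δ^{−m/2} |∇U(y/δ − η)|. Equivalently, the weighted L^q-norm (∫_{|y|<r} |y|^q |∇ W_δ|^q dy)^{1/q} is bounded by C^{1/q} δ². -/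
open MeasureTheory Metric

/-- The concentrating function `W_δ(y) = δ^{-(m-2)/2} U(y/δ - η)`. -/
noncomputable def Wfun (m : ℕ) (η : EuclideanSpace ℝ (Fin m)) (δ : ℝ)
    (y : EuclideanSpace ℝ (Fin m)) : ℝ :=
  δ ^ (-(((m : ℝ) - 2) / 2)) * bubble m (δ⁻¹ • y - η)

theorem hasGradientAt_const_mul_comp_smul_sub {E : Type*} [NormedAddCommGroup E]
    [InnerProductSpace ℝ E] [CompleteSpace E] {f : E → ℝ} {g : E} (c a : ℝ) (η y : E)
    (hf : HasGradientAt f g (a • y - η)) :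
    HasGradientAt (fun x => c * f (a • x - η)) ((c * a) • g) y := by
  rw [hasGradientAt_iff_hasFDerivAt] at hf ⊢
  have h : HasFDerivAt (fun x : E => a • x - η) (a • ContinuousLinearMap.id ℝ E) y :=
    ((hasFDerivAt_id y).const_smul a).sub_const η
  refine ((hf.comp y h).const_mul c).congr_fderiv ?_
  ext v
  simp [mul_assoc]

theorem hasGradientAt_one_add_norm_sq_rpow {E : Type*} [NormedAddCommGroup E]
    [InnerProductSpace ℝ E] [CompleteSpace E] (p : ℝ) (z : E) :
    HasGradientAt (fun x : E => (1 + ‖x‖ ^ 2) ^ p)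
      ((2 * p * (1 + ‖z‖ ^ 2) ^ (p - 1)) • z) z := by
  rw [hasGradientAt_iff_hasFDerivAt]
  have h : HasFDerivAt (fun x : E => 1 + ‖x‖ ^ 2) (2 • innerSL ℝ z) z :=
    (hasStrictFDerivAt_norm_sq z).hasFDerivAt.const_add 1
  have hpos : 1 + ‖z‖ ^ 2 ≠ 0 := by positivity
  refine (h.rpow_const (Or.inl hpos)).congr_fderiv ?_
  ext v
  simp
  ring

/-- The norm of the gradient of the standard bubble. -/
noncomputable def bubbleGradNorm (m : ℕ) (z : EuclideanSpace ℝ (Fin m)) : ℝ :=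
  ((m : ℝ) * ((m : ℝ) - 2)) ^ (((m : ℝ) - 2) / 4) * ((m : ℝ) - 2) *
    (‖z‖ * (1 + ‖z‖ ^ 2) ^ (-(m : ℝ) / 2))

theorem norm_gradient_Wfun {m : ℕ} (hm : 2 ≤ m) (η y : EuclideanSpace ℝ (Fin m)) {δ : ℝ}
    (hδ : 0 < δ) :
    ‖gradient (Wfun m η δ) y‖ = δ ^ (-((m : ℝ) / 2)) * bubbleGradNorm m (δ⁻¹ • y - η) := by
  have hm' : (2 : ℝ) ≤ m := by exact_mod_cast hm
  set A : ℝ := ((m : ℝ) * ((m : ℝ) - 2)) ^ (((m : ℝ) - 2) / 4) with hA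
  have hA0 : 0 ≤ A := Real.rpow_nonneg (mul_nonneg (by linarith) (by linarith)) _
  have hg := (hasGradientAt_const_mul_comp_smul_sub (δ ^ (-(((m : ℝ) - 2) / 2)) * A) δ⁻¹ η y
    (hasGradientAt_one_add_norm_sq_rpow (-(((m : ℝ) - 2) / 2)) (δ⁻¹ • y - η)))
  have hW : Wfun m η δ = fun x => δ ^ (-(((m : ℝ) - 2) / 2)) * A *
      (1 + ‖δ⁻¹ • x - η‖ ^ 2) ^ (-(((m : ℝ) - 2) / 2)) := by
    ext x
    simp only [Wfun, bubble, hA, mul_assoc]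
  have hpow : δ ^ (-((m : ℝ) / 2)) = δ ^ (-(((m : ℝ) - 2) / 2)) * δ⁻¹ := by
    rw [← Real.rpow_neg_one δ, ← Real.rpow_add hδ]
    congr 1
    ring
  rw [hW, hg.gradient, bubbleGradNorm, ← hA, hpow]
  have hexp : -(((m : ℝ) - 2) / 2) - 1 = -(m : ℝ) / 2 := by ring
  have hB : 0 ≤ (1 + ‖δ⁻¹ • y - η‖ ^ 2) ^ (-(m : ℝ) / 2) := by positivity
  have hδ' : 0 ≤ δ ^ (-(((m : ℝ) - 2) / 2)) := by positivity
  rw [norm_smul, norm_smul, hexp, Real.norm_eq_abs, Real.norm_eq_abs, abs_mul, abs_mul, abs_mul,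
    abs_mul, abs_of_nonneg hA0, abs_of_nonneg hB, abs_of_nonneg hδ', abs_of_pos (inv_pos.2 hδ),
    abs_of_nonpos (by linarith : -(((m : ℝ) - 2) / 2) ≤ 0), abs_two]
  ring

theorem bubbleGradNorm_nonneg {m : ℕ} (hm : 2 ≤ m) (z : EuclideanSpace ℝ (Fin m)) :
    0 ≤ bubbleGradNorm m z := by
  have hm' : (2 : ℝ) ≤ m := by exact_mod_cast hm
  have h : 0 ≤ (m : ℝ) - 2 := by linarith
  unfold bubbleGradNorm
  positivity

theorem continuous_bubbleGradNorm (m : ℕ) : Continuous (bubbleGradNorm m) := by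
  unfold bubbleGradNorm
  refine continuous_const.mul (continuous_norm.mul ?_)
  exact Continuous.rpow_const (by fun_prop) fun z => Or.inl (by positivity)

theorem exists_norm_mul_bubbleGradNorm_le {m : ℕ} (hm : 2 ≤ m) (η : EuclideanSpace ℝ (Fin m)) :
    ∃ K : ℝ, 0 ≤ K ∧ ∀ x : EuclideanSpace ℝ (Fin m),
      ‖x‖ * bubbleGradNorm m (x - η) ≤ K * (1 + ‖x - η‖) ^ (-((m : ℝ) - 2)) := by
  have hm' : (2 : ℝ) ≤ m := by exact_mod_cast hm
  have hm2 : 0 ≤ (m : ℝ) - 2 := by linarith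
  set A : ℝ := ((m : ℝ) * ((m : ℝ) - 2)) ^ (((m : ℝ) - 2) / 4) * ((m : ℝ) - 2) with hA
  have hA0 : 0 ≤ A := by positivity
  refine ⟨(1 + ‖η‖) * (A * 2 ^ ((m : ℝ) / 2)), by positivity, fun x => ?_⟩
  set z := x - η with hz
  have hx : ‖x‖ ≤ (1 + ‖η‖) * (1 + ‖z‖) := by
    have h : ‖x‖ ≤ ‖z‖ + ‖η‖ := by simpa [hz] using norm_add_le z η
    nlinarith [norm_nonneg z, norm_nonneg η, mul_nonneg (norm_nonneg z) (norm_nonneg η)]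
  have hdecay : (1 + ‖z‖ ^ 2) ^ (-(m : ℝ) / 2) ≤
      2 ^ ((m : ℝ) / 2) * (1 + ‖z‖) ^ (-(m : ℝ)) :=
    rpow_neg_one_add_norm_sq_le z (by linarith)
  have hpow : (1 + ‖z‖) ^ (-((m : ℝ) - 2)) = (1 + ‖z‖) * (1 + ‖z‖) * (1 + ‖z‖) ^ (-(m : ℝ)) := by
    have h : 0 < 1 + ‖z‖ := by positivity
    rw [← sq, ← Real.rpow_two, ← Real.rpow_add h]
    congr 1
    ring
  calc ‖x‖ * bubbleGradNorm m z
      ≤ ((1 + ‖η‖) * (1 + ‖z‖)) *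
          (A * ((1 + ‖z‖) * (2 ^ ((m : ℝ) / 2) * (1 + ‖z‖) ^ (-(m : ℝ))))) := by
        unfold bubbleGradNorm
        rw [← hA]
        gcongr
        linarith
    _ = _ := by rw [hpow]; ring

theorem integrable_norm_rpow_mul_bubbleGradNorm_rpow {m : ℕ} (hm : 2 ≤ m) {q : ℝ} (hq : 0 ≤ q)
    (hmq : (m : ℝ) < ((m : ℝ) - 2) * q) (η : EuclideanSpace ℝ (Fin m)) :
    Integrable fun x : EuclideanSpace ℝ (Fin m) => ‖x‖ ^ q * bubbleGradNorm m (x - η) ^ q := by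
  obtain ⟨K, hK, hle⟩ := exists_norm_mul_bubbleGradNorm_le hm η
  have hint : Integrable fun z : EuclideanSpace ℝ (Fin m) =>
      (1 + ‖z‖) ^ (-(((m : ℝ) - 2) * q)) :=
    integrable_one_add_norm (by simpa using hmq)
  refine ((hint.comp_sub_right η).const_mul (K ^ q)).mono' ?_ (Filter.Eventually.of_forall ?_)
  · exact ((continuous_norm.rpow_const fun _ => Or.inr hq).mul
      (((continuous_bubbleGradNorm m).comp (continuous_id.sub continuous_const)).rpow_const
        fun _ => Or.inr hq)).aestronglyMeasurable
  · intro x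
    have h0 := bubbleGradNorm_nonneg hm (x - η)
    have h1 : 0 ≤ 1 + ‖x - η‖ := by positivity
    rw [← Real.mul_rpow (norm_nonneg x) h0, Real.norm_of_nonneg (by positivity), ← neg_mul,
      Real.rpow_mul h1, ← Real.mul_rpow hK (by positivity)]
    exact Real.rpow_le_rpow (by positivity) (hle x) hq

/-- For `m ≥ 9` and `q = 2m/(m+2)`: for every `η ∈ ℝ^m` and every `r > 0` there is `C > 0`
such that for all `δ ∈ (0,1)`, the weighted integral `∫_{|y|<r} |y|^q |∇W_δ(y)|^q dy` is
finite and bounded by `C δ^{2q}`. -/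
theorem weighted_gradient_estimate (m : ℕ) (hm : 9 ≤ m)
    (η : EuclideanSpace ℝ (Fin m)) (r : ℝ) (hr : 0 < r) :
    ∃ C > (0 : ℝ), ∀ δ : ℝ, δ ∈ Set.Ioo (0 : ℝ) 1 →
      IntegrableOn (fun y : EuclideanSpace ℝ (Fin m) =>
        ‖y‖ ^ (2 * (m : ℝ) / ((m : ℝ) + 2)) *
          ‖gradient (Wfun m η δ) y‖ ^ (2 * (m : ℝ) / ((m : ℝ) + 2)))
        (ball (0 : EuclideanSpace ℝ (Fin m)) r) ∧
      (∫ y in ball (0 : EuclideanSpace ℝ (Fin m)) r,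
        ‖y‖ ^ (2 * (m : ℝ) / ((m : ℝ) + 2)) *
          ‖gradient (Wfun m η δ) y‖ ^ (2 * (m : ℝ) / ((m : ℝ) + 2))) ≤
        C * δ ^ (2 * (2 * (m : ℝ) / ((m : ℝ) + 2))) := by
  have hm9 : (9 : ℝ) ≤ m := by exact_mod_cast hm
  have hm2 : 2 ≤ m := by omega
  have hmq : (m : ℝ) < ((m : ℝ) - 2) * (2 * (m : ℝ) / ((m : ℝ) + 2)) := by
    rw [← mul_div_assoc, lt_div_iff₀ (by linarith)]
    nlinarith
  have hexp : 2 * (2 * (m : ℝ) / ((m : ℝ) + 2)) = 2 * (m : ℝ) / ((m : ℝ) + 2) +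
      -((m : ℝ) / 2) * (2 * (m : ℝ) / ((m : ℝ) + 2)) + m := by
    field_simp
    ring
  have hq : 0 ≤ 2 * (m : ℝ) / ((m : ℝ) + 2) := by positivity
  set q : ℝ := 2 * (m : ℝ) / ((m : ℝ) + 2)
  have hF := integrable_norm_rpow_mul_bubbleGradNorm_rpow hm2 hq hmq η
  set F : EuclideanSpace ℝ (Fin m) → ℝ := fun x => ‖x‖ ^ q * bubbleGradNorm m (x - η) ^ q with hFdef
  have hF0 : 0 ≤ ∫ x, F x := integral_nonneg fun x =>
    mul_nonneg (by positivity) (Real.rpow_nonneg (bubbleGradNorm_nonneg hm2 _) _)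
  refine ⟨(∫ x, F x) + 1, by linarith, fun δ hδ => ?_⟩
  have hδ0 : 0 < δ := hδ.1
  have hscale : (fun y : EuclideanSpace ℝ (Fin m) => ‖y‖ ^ q * ‖gradient (Wfun m η δ) y‖ ^ q) =
      fun y => δ ^ (q + -((m : ℝ) / 2) * q) * F (δ⁻¹ • y) := by
    ext y
    have hy : ‖y‖ = δ * ‖δ⁻¹ • y‖ := by
      rw [norm_smul, Real.norm_of_nonneg (by positivity), mul_inv_cancel_left₀ hδ0.ne']
    rw [norm_gradient_Wfun hm2 η y hδ0, hFdef, hy,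
      Real.mul_rpow hδ0.le (norm_nonneg _),
      Real.mul_rpow (by positivity) (bubbleGradNorm_nonneg hm2 _), ← Real.rpow_mul hδ0.le,
      Real.rpow_add hδ0]
    ring
  have hint : Integrable fun y : EuclideanSpace ℝ (Fin m) =>
      ‖y‖ ^ q * ‖gradient (Wfun m η δ) y‖ ^ q := by
    rw [hscale]
    exact (hF.comp_smul (inv_ne_zero hδ0.ne')).const_mul _
  refine ⟨hint.integrableOn, ?_⟩
  calc ∫ y in ball (0 : EuclideanSpace ℝ (Fin m)) r, ‖y‖ ^ q * ‖gradient (Wfun m η δ) y‖ ^ q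
      ≤ ∫ y, ‖y‖ ^ q * ‖gradient (Wfun m η δ) y‖ ^ q :=
        setIntegral_le_integral hint (Filter.Eventually.of_forall fun y => by positivity)
    _ = (∫ x, F x) * δ ^ (2 * q) := by
        rw [hscale, integral_const_mul, Measure.integral_comp_inv_smul_of_nonneg _ _ hδ0.le,
          finrank_euclideanSpace_fin, smul_eq_mul, hexp, Real.rpow_add hδ0 _ (m : ℝ),
          Real.rpow_natCast]
        ring
    _ ≤ ((∫ x, F x) + 1) * δ ^ (2 * q) := by
        gcongr
        linarith
end
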